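/- (Carleman estimate) Let T > 0 and L > 0. Then there exist a smooth positive function ψ on [−L, L] and positive constants s₀ = s₀(L,T) and C = C(L,T) such that for all s ≥ s₀ and every function q : [0,T] × [−L,L] → ℝ which is continuous together with its partial derivatives q_t, q_x, q_xx, q_xxx, and which satisfies q(t, ±L) = q_x(t, ±L) = q_xx(t, ±L) = 0 for all 0 ≤ t ≤ T, the following inequality holds: ∫₀^T ∫_{−L}^{L} { (s⁵/(t⁵(T−t)⁵)) |q|² + (s³/(t³(T−t)³)) |q_x|² + (s/(t(T−t))) |q_xx|² } e^{−2sψ(x)/(t(T−t))} dx dt ≤ C ∫₀^T ∫_{−L}^{L} |q_t − q_xx + q_xxx|² e^{−2sψ(x)/(t(T−t))} dx dt. -/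

import Mathlib

open MeasureTheory Filter Set
open scoped Topology

theorem integral_eq_zero_of_primitive {L : ℝ} (hL : 0 < L) {Y Y' : ℝ → ℝ}
    (hY : ∀ x ∈ Icc (-L) L, HasDerivWithinAt Y (Y' x) (Icc (-L) L) x)
    (hY' : ContinuousOn Y' (Icc (-L) L)) (h0 : Y (-L) = 0) (h1 : Y L = 0) :
    ∫ x in (-L)..L, Y' x = 0 := by
  have hLL : -L ≤ L := by linarith
  rw [intervalIntegral.integral_eq_sub_of_hasDerivAt_of_le hLL
    (fun x hx => (hY x hx).continuousWithinAt)
    (fun x hx => (hY x (Ioo_subset_Icc_self hx)).hasDerivAt (Icc_mem_nhds hx.1 hx.2))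
    (by apply ContinuousOn.intervalIntegrable; rwa [uIcc_of_le hLL]), h0, h1, sub_zero]

theorem integral_symm_mul_antisymm {L : ℝ} (hL : 0 < L) (σ : ℝ) {w w1 w2 w3 : ℝ → ℝ}
    (h0 : ∀ x ∈ Icc (-L) L, HasDerivWithinAt w (w1 x) (Icc (-L) L) x)
    (h1 : ∀ x ∈ Icc (-L) L, HasDerivWithinAt w1 (w2 x) (Icc (-L) L) x)
    (h2 : ∀ x ∈ Icc (-L) L, HasDerivWithinAt w2 (w3 x) (Icc (-L) L) x)
    (h3 : ContinuousOn w3 (Icc (-L) L))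
    (hb : w (-L) = 0 ∧ w L = 0 ∧ w1 (-L) = 0 ∧ w1 L = 0 ∧ w2 (-L) = 0 ∧ w2 L = 0) :
    ∫ x in (-L)..L, ((3 * σ * (2 * (2 * L - x)) * w2 x - 6 * σ * w1 x
        + σ ^ 3 * (2 * (2 * L - x)) ^ 3 * w x)
        * (w3 x + 3 * σ ^ 2 * (2 * (2 * L - x)) ^ 2 * w1 x
          - 6 * σ ^ 2 * (2 * (2 * L - x)) * w x)
      - (9 * σ * (w2 x ^ 2 + 2 * σ ^ 2 * (2 * (2 * L - x)) ^ 2 * w1 x ^ 2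
          + σ ^ 4 * (2 * (2 * L - x)) ^ 4 * w x ^ 2) - 12 * σ ^ 3 * w x ^ 2)) = 0 := by
  obtain ⟨b1, b2, b3, b4, b5, b6⟩ := hb
  have c0 : ContinuousOn w (Icc (-L) L) := fun x hx => (h0 x hx).continuousWithinAt
  have c1 : ContinuousOn w1 (Icc (-L) L) := fun x hx => (h1 x hx).continuousWithinAt
  have c2 : ContinuousOn w2 (Icc (-L) L) := fun x hx => (h2 x hx).continuousWithinAt
  refine integral_eq_zero_of_primitive hL (Y := fun x =>
    3 / 2 * (σ * (2 * (2 * L - x))) * w2 x ^ 2 + 4 * (σ * (2 * (2 * L - x))) ^ 3 * w1 x ^ 2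
    - 12 * σ * (σ * (2 * (2 * L - x))) ^ 2 * (w x * w1 x)
    - 6 * σ ^ 2 * (σ * (2 * (2 * L - x))) * w x ^ 2
    - 6 * σ * (w1 x * w2 x) + (σ * (2 * (2 * L - x))) ^ 3 * (w x * w2 x)
    + 3 / 2 * (σ * (2 * (2 * L - x))) ^ 5 * w x ^ 2) ?_ (by fun_prop) ?_ ?_
  · intro x hx
    have hp : HasDerivWithinAt (fun x => σ * (2 * (2 * L - x))) (σ * (2 * (-1))) (Icc (-L) L) x :=
      (((hasDerivWithinAt_id x _).const_sub (2 * L)).const_mul 2).const_mul σ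
    have d0 := h0 x hx
    have d1 := h1 x hx
    have d2 := h2 x hx
    refine ((((((((hp.const_mul (3 / 2)).mul (d2.pow 2)).add
      (((hp.pow 3).const_mul 4).mul (d1.pow 2))).sub
      (((hp.pow 2).const_mul (12 * σ)).mul (d0.mul d1))).sub
      ((hp.const_mul (6 * σ ^ 2)).mul (d0.pow 2))).sub
      ((d1.mul d2).const_mul (6 * σ))).add
      ((hp.pow 3).mul (d0.mul d2))).add
      (((hp.pow 5).const_mul (3 / 2)).mul (d0.pow 2))).congr_deriv ?_
    simp only [Pi.pow_apply, Pi.mul_apply]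
    push_cast
    ring
  · simp [b1, b3, b5]
  · simp [b2, b4, b6]

theorem integral_affine_mul_deriv_mul_deriv {L : ℝ} (hL : 0 < L) {u u1 v1 v2 : ℝ → ℝ}
    (hu : ∀ x ∈ Icc (-L) L, HasDerivWithinAt u (u1 x) (Icc (-L) L) x)
    (hv : ∀ x ∈ Icc (-L) L, HasDerivWithinAt v1 (v2 x) (Icc (-L) L) x)
    (hu1 : ContinuousOn u1 (Icc (-L) L)) (hv2 : ContinuousOn v2 (Icc (-L) L))
    (hb : u (-L) = 0 ∧ u L = 0) :
    ∫ x in (-L)..L, (2 * (2 * L - x) * (u1 x * v1 x)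
      + u x * (2 * (2 * L - x) * v2 x - 2 * v1 x)) = 0 := by
  have c0 : ContinuousOn u (Icc (-L) L) := fun x hx => (hu x hx).continuousWithinAt
  have c1 : ContinuousOn v1 (Icc (-L) L) := fun x hx => (hv x hx).continuousWithinAt
  refine integral_eq_zero_of_primitive hL (Y := fun x => 2 * (2 * L - x) * (u x * v1 x)) ?_
    (by fun_prop) (by simp [hb.1]) (by simp [hb.2])
  intro x hx
  have hp : HasDerivWithinAt (fun x => 2 * (2 * L - x)) (2 * (-1)) (Icc (-L) L) x :=
    ((hasDerivWithinAt_id x _).const_sub (2 * L)).const_mul 2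
  refine (hp.mul ((hu x hx).mul (hv x hx))).congr_deriv ?_
  simp only [Pi.mul_apply]
  ring

/-- Joint-continuity version of differentiating `∫ (u τ x - u t x) g τ x dx` at `τ = t`, where `g`
need not be differentiable in time. -/
theorem hasDerivAt_integral_sub_mul {a b t : ℝ} {S : Set ℝ} (hab : a ≤ b) (hS : IsOpen S)
    (ht : t ∈ S) {u ut g : ℝ → ℝ → ℝ}
    (hu : ∀ τ ∈ S, ∀ x ∈ Icc a b, HasDerivAt (fun r => u r x) (ut τ x) τ)
    (cu : ContinuousOn (Function.uncurry u) (S ×ˢ Icc a b))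
    (cut : ContinuousOn (Function.uncurry ut) (S ×ˢ Icc a b))
    (cg : ContinuousOn (Function.uncurry g) (S ×ˢ Icc a b)) :
    HasDerivAt (fun τ => ∫ x in a..b, (u τ x - u t x) * g τ x)
      (∫ x in a..b, ut t x * g t x) t := by
  obtain ⟨ε, hε, hball⟩ := Metric.nhds_basis_closedBall.mem_iff.1 (hS.mem_nhds ht)
  have slice : ∀ f : ℝ → ℝ → ℝ, ContinuousOn (Function.uncurry f) (S ×ˢ Icc a b) →
      ∀ τ ∈ S, ContinuousOn (f τ) (Icc a b) := fun f hf τ hτ =>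
    hf.comp (f := fun x => (τ, x)) (by fun_prop) (fun x hx => ⟨hτ, hx⟩)
  have hcomp : IsCompact (Metric.closedBall t ε ×ˢ Icc a b) :=
    (isCompact_closedBall t ε).prod isCompact_Icc
  have hsub : Metric.closedBall t ε ×ˢ Icc a b ⊆ S ×ˢ Icc a b := prod_mono hball subset_rfl
  obtain ⟨C, hC⟩ := hcomp.exists_bound_of_continuousOn (cut.mono hsub)
  obtain ⟨D, hD⟩ := hcomp.exists_bound_of_continuousOn (cg.mono hsub)
  have tmem : t ∈ Metric.closedBall t ε := Metric.mem_closedBall_self hε.le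
  have hmem : ∀ᶠ τ in 𝓝[≠] t, τ ∈ Metric.closedBall t ε :=
    nhdsWithin_le_nhds (Metric.closedBall_mem_nhds t hε)
  rw [hasDerivAt_iff_tendsto_slope]
  have key : Tendsto (fun τ => ∫ x in a..b, slope (fun r => u r x) t τ * g τ x) (𝓝[≠] t)
      (𝓝 (∫ x in a..b, ut t x * g t x)) := by
    refine intervalIntegral.tendsto_integral_filter_of_dominated_convergence (fun _ => C * D)
      ?_ ?_ intervalIntegrable_const ?_
    · filter_upwards [hmem] with τ hτ
      rw [uIoc_of_le hab]
      refine (ContinuousOn.mono ?_ Ioc_subset_Icc_self).aestronglyMeasurable measurableSet_Ioc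
      have h1 := slice u cu τ (hball hτ)
      have h2 := slice u cu t ht
      have h3 := slice g cg τ (hball hτ)
      simp only [slope_def_field]
      fun_prop
    · filter_upwards [hmem, self_mem_nhdsWithin] with τ hτ hne
      refine ae_of_all _ fun x hx => ?_
      rw [uIoc_of_le hab] at hx
      have hx' := Ioc_subset_Icc_self hx
      rw [norm_mul]
      refine mul_le_mul ?_ (hD (τ, x) ⟨hτ, hx'⟩) (norm_nonneg _)
        ((norm_nonneg _).trans (hC (t, x) ⟨tmem, hx'⟩))
      have := (convex_closedBall t ε).norm_image_sub_le_of_norm_hasDerivWithin_le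
        (f := fun r => u r x) (f' := fun r => ut r x) (C := C)
        (fun r hr => (hu r (hball hr) x hx').hasDerivWithinAt)
        (fun r hr => hC (r, x) ⟨hr, hx'⟩) tmem hτ
      rw [slope_def_field, norm_div]
      have hpos : 0 < ‖τ - t‖ := norm_pos_iff.2 (sub_ne_zero.2 hne)
      rwa [div_le_iff₀ hpos]
    · refine ae_of_all _ fun x hx => ?_
      rw [uIoc_of_le hab] at hx
      have hx' := Ioc_subset_Icc_self hx
      refine (hasDerivAt_iff_tendsto_slope.1 (hu t ht x hx')).mul ?_
      have h1 : ContinuousOn (fun τ => g τ x) S :=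
        cg.comp (f := fun τ => (τ, x)) (by fun_prop) (fun r hr => ⟨hr, hx'⟩)
      exact (h1.continuousAt (hS.mem_nhds ht)).tendsto.mono_left nhdsWithin_le_nhds
  refine key.congr fun τ => ?_
  rw [slope_def_field]
  simp only [sub_self, zero_mul, intervalIntegral.integral_zero, sub_zero, slope_def_field]
  rw [← intervalIntegral.integral_div]
  congr 1
  ext x
  ring

theorem hasDerivAt_energy {L t σ' : ℝ} (hL : 0 < L) {S : Set ℝ} (hS : IsOpen S) (ht : t ∈ S)
    {σ : ℝ → ℝ} (hσ : HasDerivAt σ σ' t) {w wt w1 w2 : ℝ → ℝ → ℝ}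
    (hwt : ∀ τ ∈ S, ∀ x ∈ Icc (-L) L, HasDerivAt (fun r => w r x) (wt τ x) τ)
    (h0 : ∀ τ ∈ S, ∀ x ∈ Icc (-L) L, HasDerivWithinAt (w τ) (w1 τ x) (Icc (-L) L) x)
    (h1 : ∀ τ ∈ S, ∀ x ∈ Icc (-L) L, HasDerivWithinAt (w1 τ) (w2 τ x) (Icc (-L) L) x)
    (cw : ContinuousOn (Function.uncurry w) (S ×ˢ Icc (-L) L))
    (cwt : ContinuousOn (Function.uncurry wt) (S ×ˢ Icc (-L) L))
    (cw1 : ContinuousOn (Function.uncurry w1) (S ×ˢ Icc (-L) L))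
    (cw2 : ContinuousOn (Function.uncurry w2) (S ×ˢ Icc (-L) L))
    (hb : ∀ τ ∈ S, w τ (-L) = 0 ∧ w τ L = 0) :
    HasDerivAt (fun τ => -(3 / 2) * σ τ * (∫ x in (-L)..L, 2 * (2 * L - x) * w1 τ x ^ 2)
        + 1 / 2 * σ τ ^ 3 * ∫ x in (-L)..L, (2 * (2 * L - x)) ^ 3 * w τ x ^ 2)
      (∫ x in (-L)..L, ((3 * σ t * (2 * (2 * L - x)) * w2 t x - 6 * σ t * w1 t x
          + σ t ^ 3 * (2 * (2 * L - x)) ^ 3 * w t x) * wt t x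
        - (3 / 2 * σ' * (2 * (2 * L - x)) * w1 t x ^ 2
          - 3 / 2 * σ t ^ 2 * σ' * (2 * (2 * L - x)) ^ 3 * w t x ^ 2))) t := by
  have hLL : -L ≤ L := by linarith
  have slice : ∀ f : ℝ → ℝ → ℝ, ContinuousOn (Function.uncurry f) (S ×ˢ Icc (-L) L) →
      ∀ τ ∈ S, ContinuousOn (f τ) (Icc (-L) L) := fun f hf τ hτ =>
    hf.comp (f := fun x => (τ, x)) (by fun_prop) (fun x hx => ⟨hτ, hx⟩)
  have cti : ∀ f : ℝ → ℝ → ℝ, ContinuousOn (Function.uncurry f) (S ×ˢ Icc (-L) L) →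
      ContinuousOn (fun z : ℝ × ℝ => f t z.2) (S ×ˢ Icc (-L) L) := fun f hf =>
    (slice f hf t ht).comp (f := fun z : ℝ × ℝ => z.2) (by fun_prop) (fun z hz => hz.2)
  have ii : ∀ f : ℝ → ℝ, ContinuousOn f (Icc (-L) L) → IntervalIntegrable f volume (-L) L :=
    fun f hf => by apply ContinuousOn.intervalIntegrable; rwa [uIcc_of_le hLL]
  have kw := cti w cw
  have kw1 := cti w1 cw1
  have kw2 := cti w2 cw2
  have sw := slice w cw t ht
  have sw1 := slice w1 cw1 t ht
  have sw2 := slice w2 cw2 t ht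
  have swt := slice wt cwt t ht
  have dV := hasDerivAt_integral_sub_mul (g := fun τ x => (2 * (2 * L - x)) ^ 3 * (w τ x + w t x))
    hLL hS ht hwt cw cwt (.mul (by fun_prop) (cw.add kw))
  have dM := hasDerivAt_integral_sub_mul (g := fun τ x =>
    2 * (2 * L - x) * (w2 τ x + w2 t x) - 2 * (w1 τ x + w1 t x))
    hLL hS ht hwt cw cwt (.sub (.mul (by fun_prop) (cw2.add kw2)) (continuousOn_const.mul (cw1.add kw1)))
  have eV : ∀ τ ∈ S, (∫ x in (-L)..L, (2 * (2 * L - x)) ^ 3 * w τ x ^ 2) =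
      (∫ x in (-L)..L, (w τ x - w t x) * ((2 * (2 * L - x)) ^ 3 * (w τ x + w t x)))
        + ∫ x in (-L)..L, (2 * (2 * L - x)) ^ 3 * w t x ^ 2 := fun τ hτ => by
    have sτ := slice w cw τ hτ
    rw [← intervalIntegral.integral_add (ii _ (by fun_prop)) (ii _ (by fun_prop))]
    congr 1
    ext x
    ring
  have eM : ∀ τ ∈ S, (∫ x in (-L)..L, 2 * (2 * L - x) * w1 τ x ^ 2) =
      (∫ x in (-L)..L, 2 * (2 * L - x) * w1 t x ^ 2)
        - ∫ x in (-L)..L, (w τ x - w t x) *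
          (2 * (2 * L - x) * (w2 τ x + w2 t x) - 2 * (w1 τ x + w1 t x)) := fun τ hτ => by
    have sτ := slice w cw τ hτ
    have sτ1 := slice w1 cw1 τ hτ
    have sτ2 := slice w2 cw2 τ hτ
    have := integral_affine_mul_deriv_mul_deriv hL
      (u := fun x => w τ x - w t x) (u1 := fun x => w1 τ x - w1 t x)
      (v1 := fun x => w1 τ x + w1 t x) (v2 := fun x => w2 τ x + w2 t x)
      (fun x hx => (h0 τ hτ x hx).sub (h0 t ht x hx))
      (fun x hx => (h1 τ hτ x hx).add (h1 t ht x hx))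
      (by fun_prop) (by fun_prop) (by simp [hb τ hτ, hb t ht])
    rw [← intervalIntegral.integral_sub (ii _ (by fun_prop)) (ii _ (by fun_prop)), ← sub_eq_zero,
      ← intervalIntegral.integral_sub (ii _ (by fun_prop)) (ii _ (by fun_prop)), ← this]
    congr 1
    ext x
    ring
  have dV' := (dV.add_const (∫ x in (-L)..L, (2 * (2 * L - x)) ^ 3 * w t x ^ 2)).congr_of_eventuallyEq
    (eventuallyEq_of_mem (hS.mem_nhds ht) eV)
  have dM' := (dM.const_sub (∫ x in (-L)..L, 2 * (2 * L - x) * w1 t x ^ 2)).congr_of_eventuallyEq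
    (eventuallyEq_of_mem (hS.mem_nhds ht) eM)
  refine (((hσ.const_mul (-(3 / 2))).mul dM').add
    (((hσ.pow 3).const_mul (1 / 2)).mul dV')).congr_deriv ?_
  simp only [Pi.pow_apply]
  rw [← intervalIntegral.integral_neg]
  simp only [← intervalIntegral.integral_const_mul]
  rw [← intervalIntegral.integral_add (ii _ (by fun_prop)) (ii _ (by fun_prop)),
    ← intervalIntegral.integral_add (ii _ (by fun_prop)) (ii _ (by fun_prop)),
    ← intervalIntegral.integral_add (ii _ (by fun_prop)) (ii _ (by fun_prop))]
  congr 1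
  ext x
  push_cast
  ring

theorem coercivity_of_large_parameter {L κ σ σ' p ψ w w1 w2 : ℝ} (hL : 0 < L) (hκL : κ ≤ L) (hκ : κ ≤ 1 / 4)
    (hσ : 2 ≤ σ) (hσL : 1 ≤ σ * L ^ 2) (hp : 2 * L ≤ p) (hψ0 : 0 ≤ ψ) (hψ : ψ ≤ 16 * L ^ 2)
    (hσ' : |σ'| ≤ κ * σ ^ 2) :
    σ * w2 ^ 2 + σ ^ 3 * p ^ 2 * w1 ^ 2 + σ ^ 5 * p ^ 4 * w ^ 2 ≤
      4 * (9 * σ * (w2 ^ 2 + 2 * σ ^ 2 * p ^ 2 * w1 ^ 2 + σ ^ 4 * p ^ 4 * w ^ 2)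
          - 12 * σ ^ 3 * w ^ 2 + 3 / 2 * σ' * p * w1 ^ 2 - 3 / 2 * σ ^ 2 * σ' * p ^ 3 * w ^ 2)
        - 2 * (w2 + 2 * (σ * p) * w1 + ((σ * p) ^ 2 - 2 * σ - σ' * ψ) * w) ^ 2 := by
  have hp0 : 0 < p := by linarith
  have hσ0 : 0 < σ := by linarith
  have hκ0 : 0 ≤ κ := by
    by_contra! h
    have : κ * σ ^ 2 < 0 := mul_neg_of_neg_of_pos h (by positivity)
    linarith [abs_nonneg σ']
  have hκp : 2 * κ ≤ p := by linarith
  have hp2 : 4 * L ^ 2 ≤ p ^ 2 := by nlinarith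
  have hp4 : 16 * L ^ 4 ≤ p ^ 4 := by
    calc 16 * L ^ 4 = (2 * L) ^ 4 := by ring
      _ ≤ p ^ 4 := by gcongr
  have hsp : 4 ≤ σ * p ^ 2 := by nlinarith
  have hsp2 : 16 ≤ σ ^ 2 * p ^ 4 := by nlinarith
  obtain ⟨hl, hu⟩ := abs_le.1 hσ'
  have hsplit : (w2 + 2 * (σ * p) * w1 + ((σ * p) ^ 2 - 2 * σ - σ' * ψ) * w) ^ 2 ≤
      3 * (w2 ^ 2 + 4 * (σ ^ 2 * p ^ 2) * w1 ^ 2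
        + 3 * ((σ * p) ^ 4 + 4 * σ ^ 2 + (σ' * ψ) ^ 2) * w ^ 2) := by
    have e1 : ((σ * p) ^ 2 - 2 * σ - σ' * ψ) ^ 2 ≤
        3 * ((σ * p) ^ 4 + 4 * σ ^ 2 + (σ' * ψ) ^ 2) := by
      nlinarith [sq_nonneg ((σ * p) ^ 2 + 2 * σ), sq_nonneg ((σ * p) ^ 2 + σ' * ψ),
        sq_nonneg (2 * σ - σ' * ψ)]
    have e2 := mul_le_mul_of_nonneg_right e1 (sq_nonneg w)
    generalize ((σ * p) ^ 2 - 2 * σ - σ' * ψ) = c at *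
    nlinarith [sq_nonneg (w2 - 2 * (σ * p) * w1), sq_nonneg (w2 - c * w),
      sq_nonneg (2 * (σ * p) * w1 - c * w)]
  have hd : (σ' * ψ) ^ 2 ≤ σ ^ 4 * p ^ 4 := by
    have h1 : |σ' * ψ| ≤ σ ^ 2 * p ^ 2 := by
      rw [abs_mul, abs_of_nonneg hψ0]
      calc |σ'| * ψ ≤ (1 / 4 * σ ^ 2) * (16 * L ^ 2) := by
            gcongr; exact hσ'.trans (by gcongr)
        _ = σ ^ 2 * (4 * L ^ 2) := by ring
        _ ≤ _ := by gcongr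
    calc (σ' * ψ) ^ 2 = |σ' * ψ| ^ 2 := (sq_abs _).symm
      _ ≤ (σ ^ 2 * p ^ 2) ^ 2 := by gcongr
      _ = _ := by ring
  have c1 : 6 ≤ 35 * σ := by linarith
  have c2 : 24 * (σ ^ 2 * p ^ 2) ≤ 71 * (σ ^ 3 * p ^ 2) + 6 * σ' * p := by
    have : κ * σ ^ 2 * p ≤ σ ^ 2 * p ^ 2 := by
      linarith [mul_nonneg (mul_nonneg (sq_nonneg σ) hp0.le) (by linarith : 0 ≤ p - κ)]
    have h2 : 2 * (σ ^ 2 * p ^ 2) ≤ σ ^ 3 * p ^ 2 := by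
      linarith [mul_nonneg (by positivity : 0 ≤ σ ^ 2 * p ^ 2) (by linarith : 0 ≤ σ - 2)]
    linarith [mul_le_mul_of_nonneg_right hl hp0.le, (by positivity : 0 ≤ σ ^ 2 * p ^ 2)]
  have c3 : 18 * ((σ * p) ^ 4 + 4 * σ ^ 2 + (σ' * ψ) ^ 2) + 48 * σ ^ 3 + 6 * σ ^ 2 * σ' * p ^ 3
      ≤ 35 * (σ ^ 5 * p ^ 4) := by
    have q1 : 2 * (σ ^ 4 * p ^ 4) ≤ σ ^ 5 * p ^ 4 := by
      linarith [mul_nonneg (by positivity : 0 ≤ σ ^ 4 * p ^ 4) (by linarith : 0 ≤ σ - 2)]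
    have q2 : 16 * σ ^ 2 ≤ σ ^ 4 * p ^ 4 := by
      linarith [mul_nonneg (sq_nonneg σ) (by linarith : 0 ≤ σ ^ 2 * p ^ 4 - 16)]
    have q3 : 16 * σ ^ 3 ≤ σ ^ 5 * p ^ 4 := by
      linarith [mul_nonneg (by positivity : 0 ≤ σ ^ 3) (by linarith : 0 ≤ σ ^ 2 * p ^ 4 - 16)]
    have q4 : σ ^ 2 * σ' * p ^ 3 ≤ 1 / 2 * (σ ^ 4 * p ^ 4) := by
      have h1 : σ' * (σ ^ 2 * p ^ 3) ≤ κ * σ ^ 2 * (σ ^ 2 * p ^ 3) := by gcongr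
      have h2 : 0 ≤ (σ ^ 4 * p ^ 3) * (p - 2 * κ) := mul_nonneg (by positivity) (by linarith)
      linarith
    linarith [(by positivity : 0 ≤ σ ^ 5 * p ^ 4)]
  have f1 := mul_le_mul_of_nonneg_right c1 (sq_nonneg w2)
  have f2 := mul_le_mul_of_nonneg_right c2 (sq_nonneg w1)
  have f3 := mul_le_mul_of_nonneg_right c3 (sq_nonneg w)
  linarith

theorem weighted_sq_le {L σ p w w1 w2 : ℝ} (hL : 0 < L)
    (hσ : 0 < σ) (hσL : 1 ≤ σ * L ^ 2) (hp : 2 * L ≤ p) :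
    σ ^ 5 * w ^ 2 + σ ^ 3 * (w1 + σ * p * w) ^ 2
      + σ * (w2 + 2 * (σ * p) * w1 + ((σ * p) ^ 2 - 2 * σ) * w) ^ 2 ≤
    (1 / L ^ 4 + 1 / L ^ 2 + 12) *
      (σ * w2 ^ 2 + σ ^ 3 * p ^ 2 * w1 ^ 2 + σ ^ 5 * p ^ 4 * w ^ 2) := by
  have hp0 : 0 < p := by linarith
  have hp2 : 4 * L ^ 2 ≤ p ^ 2 := by nlinarith
  have hp4 : 16 * L ^ 4 ≤ p ^ 4 := by
    calc 16 * L ^ 4 = (2 * L) ^ 4 := by ring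
      _ ≤ p ^ 4 := by gcongr
  have hsp : 4 ≤ σ * p ^ 2 := by nlinarith
  have a1 : 1 ≤ 1 / L ^ 4 * p ^ 4 := by
    rw [div_mul_eq_mul_div, le_div_iff₀ (by positivity)]
    nlinarith [(by positivity : 0 < L ^ 4)]
  have a2 : 4 ≤ 1 / L ^ 2 * p ^ 2 := by
    rw [div_mul_eq_mul_div, le_div_iff₀ (by positivity)]
    linarith
  have i1 : σ ^ 5 * w ^ 2 ≤ 1 / L ^ 4 * (σ ^ 5 * p ^ 4 * w ^ 2) := by
    nlinarith [mul_le_mul_of_nonneg_right a1 (by positivity : 0 ≤ σ ^ 5 * w ^ 2)]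
  have i2 : σ ^ 3 * (w1 + σ * p * w) ^ 2 ≤
      1 / L ^ 2 * (σ ^ 3 * p ^ 2 * w1 ^ 2 + σ ^ 5 * p ^ 4 * w ^ 2) := by
    have h1 : (w1 + σ * p * w) ^ 2 ≤ 2 * (w1 ^ 2 + (σ * p * w) ^ 2) := by
      nlinarith [sq_nonneg (w1 - σ * p * w)]
    have h2 := mul_le_mul_of_nonneg_left h1 (by positivity : 0 ≤ σ ^ 3)
    have h3 := mul_le_mul_of_nonneg_right a2
      (by positivity : 0 ≤ σ ^ 3 * (w1 ^ 2 + (σ * p * w) ^ 2))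
    have h4 : 0 ≤ σ ^ 3 * (w1 ^ 2 + (σ * p * w) ^ 2) := by positivity
    nlinarith
  have i3 : σ * (w2 + 2 * (σ * p) * w1 + ((σ * p) ^ 2 - 2 * σ) * w) ^ 2 ≤
      12 * (σ * w2 ^ 2 + σ ^ 3 * p ^ 2 * w1 ^ 2 + σ ^ 5 * p ^ 4 * w ^ 2) := by
    have h0 : ((σ * p) ^ 2 - 2 * σ) ^ 2 ≤ (σ * p) ^ 4 := by
      linarith [mul_nonneg (by positivity : 0 ≤ σ ^ 2) (by linarith : 0 ≤ σ * p ^ 2 - 4),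
        sq_nonneg σ]
    have h1 : (w2 + 2 * (σ * p) * w1 + ((σ * p) ^ 2 - 2 * σ) * w) ^ 2 ≤
        3 * (w2 ^ 2 + 4 * (σ * p) ^ 2 * w1 ^ 2 + (σ * p) ^ 4 * w ^ 2) := by
      have e2 := mul_le_mul_of_nonneg_right h0 (sq_nonneg w)
      generalize ((σ * p) ^ 2 - 2 * σ) = c at *
      nlinarith [sq_nonneg (w2 - 2 * (σ * p) * w1), sq_nonneg (w2 - c * w),
        sq_nonneg (2 * (σ * p) * w1 - c * w)]
    have h2 := mul_le_mul_of_nonneg_left h1 hσ.le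
    nlinarith [(by positivity : 0 ≤ σ * w2 ^ 2), (by positivity : 0 ≤ σ ^ 5 * p ^ 4 * w ^ 2)]
  have j1 : 0 ≤ 1 / L ^ 4 * (σ * w2 ^ 2 + σ ^ 3 * p ^ 2 * w1 ^ 2) := by positivity
  have j2 : 0 ≤ 1 / L ^ 2 * (σ * w2 ^ 2) := by positivity
  linarith

theorem energy_deriv_le {L κ σ σ' : ℝ} (hL : 0 < L) (hκL : κ ≤ L) (hκ : κ ≤ 1 / 4)
    (hσ : 2 ≤ σ) (hσL : 1 ≤ σ * L ^ 2) (hσ' : |σ'| ≤ κ * σ ^ 2) {w w1 w2 w3 wt : ℝ → ℝ}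
    (h0 : ∀ x ∈ Icc (-L) L, HasDerivWithinAt w (w1 x) (Icc (-L) L) x)
    (h1 : ∀ x ∈ Icc (-L) L, HasDerivWithinAt w1 (w2 x) (Icc (-L) L) x)
    (h2 : ∀ x ∈ Icc (-L) L, HasDerivWithinAt w2 (w3 x) (Icc (-L) L) x)
    (h3 : ContinuousOn w3 (Icc (-L) L)) (ht : ContinuousOn wt (Icc (-L) L))
    (hb : w (-L) = 0 ∧ w L = 0 ∧ w1 (-L) = 0 ∧ w1 L = 0 ∧ w2 (-L) = 0 ∧ w2 L = 0)
    {f E : ℝ → ℝ} (hf : ContinuousOn f (Icc (-L) L)) (hE : ContinuousOn E (Icc (-L) L))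
    (hfw : ∀ x ∈ Icc (-L) L, f x = wt x + σ' * (16 * L ^ 2 - (x - 2 * L) ^ 2) * w x
      - (w2 x + 2 * (σ * (2 * (2 * L - x))) * w1 x + ((σ * (2 * (2 * L - x))) ^ 2 - 2 * σ) * w x)
      + (w3 x + 3 * (σ * (2 * (2 * L - x))) * w2 x
        + 3 * ((σ * (2 * (2 * L - x))) ^ 2 - 2 * σ) * w1 x
        + ((σ * (2 * (2 * L - x))) ^ 3 - 6 * σ * (σ * (2 * (2 * L - x)))) * w x))
    (hEw : ∀ x ∈ Icc (-L) L, E x = σ ^ 5 * w x ^ 2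
      + σ ^ 3 * (w1 x + σ * (2 * (2 * L - x)) * w x) ^ 2
      + σ * (w2 x + 2 * (σ * (2 * (2 * L - x))) * w1 x
        + ((σ * (2 * (2 * L - x))) ^ 2 - 2 * σ) * w x) ^ 2) :
    4 * (∫ x in (-L)..L, ((3 * σ * (2 * (2 * L - x)) * w2 x - 6 * σ * w1 x
          + σ ^ 3 * (2 * (2 * L - x)) ^ 3 * w x) * wt x
        - (3 / 2 * σ' * (2 * (2 * L - x)) * w1 x ^ 2
          - 3 / 2 * σ ^ 2 * σ' * (2 * (2 * L - x)) ^ 3 * w x ^ 2))) ≤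
      2 * (∫ x in (-L)..L, f x ^ 2)
        - (1 / L ^ 4 + 1 / L ^ 2 + 12)⁻¹ * ∫ x in (-L)..L, E x := by
  have hLL : -L ≤ L := by linarith
  have ii : ∀ f : ℝ → ℝ, ContinuousOn f (Icc (-L) L) → IntervalIntegrable f volume (-L) L :=
    fun f hf => by apply ContinuousOn.intervalIntegrable; rwa [uIcc_of_le hLL]
  have c0 : ContinuousOn w (Icc (-L) L) := fun x hx => (h0 x hx).continuousWithinAt
  have c1 : ContinuousOn w1 (Icc (-L) L) := fun x hx => (h1 x hx).continuousWithinAt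
  have c2 : ContinuousOn w2 (Icc (-L) L) := fun x hx => (h2 x hx).continuousWithinAt
  have hK : 0 < 1 / L ^ 4 + 1 / L ^ 2 + 12 := by positivity
  have hz := integral_symm_mul_antisymm hL σ h0 h1 h2 h3 hb
  rw [← add_zero (∫ x in (-L)..L, (_ - (_ - _))), ← hz,
    ← intervalIntegral.integral_add (ii _ (by fun_prop)) (ii _ (by fun_prop)),
    ← intervalIntegral.integral_const_mul, ← intervalIntegral.integral_const_mul,
    ← intervalIntegral.integral_const_mul,
    ← intervalIntegral.integral_sub (ii _ (by fun_prop)) (ii _ (by fun_prop))]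
  refine intervalIntegral.integral_mono_on hLL (ii _ (by fun_prop)) (ii _ (by fun_prop)) ?_
  intro x hx
  have hp : 2 * L ≤ 2 * (2 * L - x) := by linarith [hx.2]
  have hψ0 : 0 ≤ 16 * L ^ 2 - (x - 2 * L) ^ 2 := by nlinarith [hx.1, hx.2]
  have hψ : 16 * L ^ 2 - (x - 2 * L) ^ 2 ≤ 16 * L ^ 2 := by linarith [sq_nonneg (x - 2 * L)]
  have k1 := coercivity_of_large_parameter (w := w x) (w1 := w1 x) (w2 := w2 x)
    hL hκL hκ hσ hσL hp hψ0 hψ hσ'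
  have k2 : (1 / L ^ 4 + 1 / L ^ 2 + 12)⁻¹ * E x ≤ _ := (inv_mul_le_iff₀ hK).2
    ((hEw x hx).trans_le (weighted_sq_le (w := w x) (w1 := w1 x) (w2 := w2 x)
      hL (by linarith) hσL hp))
  have k3 := hfw x hx
  generalize (1 / L ^ 4 + 1 / L ^ 2 + 12)⁻¹ * E x = e at *
  generalize 16 * L ^ 2 - (x - 2 * L) ^ 2 = ψ at *
  generalize 2 * (2 * L - x) = p at *
  generalize w x = u, w1 x = u1, w2 x = u2, w3 x = u3, wt x = ut, f x = g at *
  have k4 := sq_nonneg ((3 * σ * p * u2 - 6 * σ * u1 + σ ^ 3 * p ^ 3 * u)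
    - (ut + (u3 + 3 * σ ^ 2 * p ^ 2 * u1 - 6 * σ ^ 2 * p * u)))
  have k5 := sq_nonneg (g - (u2 + 2 * (σ * p) * u1 + ((σ * p) ^ 2 - 2 * σ - σ' * ψ) * u))
  have k6 : g + (u2 + 2 * (σ * p) * u1 + ((σ * p) ^ 2 - 2 * σ - σ' * ψ) * u) =
    (3 * σ * p * u2 - 6 * σ * u1 + σ ^ 3 * p ^ 3 * u)
    + (ut + (u3 + 3 * σ ^ 2 * p ^ 2 * u1 - 6 * σ ^ 2 * p * u)) := by rw [k3]; ring
  have k7 := congrArg (· ^ 2) k6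
  linarith

theorem hasDerivWithinAt_conj {L σ x : ℝ} {S : Set ℝ} {f : ℝ → ℝ} {f' : ℝ}
    (hf : HasDerivWithinAt f f' S x) :
    HasDerivWithinAt (fun x => Real.exp (-(σ * (16 * L ^ 2 - (x - 2 * L) ^ 2))) * f x)
      (Real.exp (-(σ * (16 * L ^ 2 - (x - 2 * L) ^ 2))) * (f' - σ * (2 * (2 * L - x)) * f x))
      S x := by
  have h := ((((((hasDerivWithinAt_id x S).sub_const (2 * L)).pow 2).const_sub
    (16 * L ^ 2)).const_mul σ).neg.exp).mul hf
  refine h.congr_deriv ?_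
  simp
  ring

theorem energy_bound {L σ Q : ℝ} (hL : 0 < L) (hσ : 0 < σ) (hσL : 1 ≤ σ * L ^ 2)
    {q q1 : ℝ → ℝ} (hq : ∀ x ∈ Icc (-L) L, |q x| ≤ Q) (hq1 : ∀ x ∈ Icc (-L) L, |q1 x| ≤ Q) :
    |-(3 / 2) * σ * (∫ x in (-L)..L, 2 * (2 * L - x) *
          (Real.exp (-(σ * (16 * L ^ 2 - (x - 2 * L) ^ 2))) *
            (q1 x - σ * (2 * (2 * L - x)) * q x)) ^ 2)
        + 1 / 2 * σ ^ 3 * ∫ x in (-L)..L, (2 * (2 * L - x)) ^ 3 *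
          (Real.exp (-(σ * (16 * L ^ 2 - (x - 2 * L) ^ 2))) * q x) ^ 2| ≤
      (24 / (14 * L ^ 2) ^ 4 * Q ^ 2 * (18 * L ^ 2 * (L ^ 2 + 6 * L) ^ 2 + 216 * L ^ 4)) / σ := by
  have hQ : 0 ≤ Q := (abs_nonneg _).trans (hq 0 ⟨by linarith, hL.le⟩)
  set B := 24 / (14 * L ^ 2 * σ) ^ 4 with hB
  have hB0 : 0 ≤ B := by positivity
  have he : ∀ x ∈ Icc (-L) L, Real.exp (-(σ * (16 * L ^ 2 - (x - 2 * L) ^ 2))) ^ 2 ≤ B := by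
    intro x hx
    have h1 : 7 * L ^ 2 ≤ 16 * L ^ 2 - (x - 2 * L) ^ 2 := by nlinarith [hx.1, hx.2]
    have h2 := Real.pow_div_factorial_le_exp (14 * L ^ 2 * σ) (by positivity) 4
    have h3 : ((4 : ℕ).factorial : ℝ) = 24 := by norm_num [Nat.factorial]
    rw [h3] at h2
    rw [← Real.exp_nat_mul]
    calc Real.exp ((2 : ℕ) * -(σ * (16 * L ^ 2 - (x - 2 * L) ^ 2)))
        ≤ Real.exp (-(14 * L ^ 2 * σ)) := by
          apply Real.exp_le_exp.2
          push_cast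
          nlinarith [mul_le_mul_of_nonneg_left h1 hσ.le]
      _ = (Real.exp (14 * L ^ 2 * σ))⁻¹ := Real.exp_neg _
      _ ≤ ((14 * L ^ 2 * σ) ^ 4 / 24)⁻¹ := by gcongr
      _ = B := by rw [hB, inv_div]
  have hp : ∀ x ∈ Icc (-L) L, 0 ≤ 2 * (2 * L - x) ∧ 2 * (2 * L - x) ≤ 6 * L := fun x hx =>
    ⟨by linarith [hx.2], by linarith [hx.1]⟩
  have hLL : -L ≤ L := by linarith
  have i1 := intervalIntegral.norm_integral_le_of_norm_le_const (a := -L) (b := L)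
    (f := fun x => 2 * (2 * L - x) *
          (Real.exp (-(σ * (16 * L ^ 2 - (x - 2 * L) ^ 2))) *
            (q1 x - σ * (2 * (2 * L - x)) * q x)) ^ 2)
    (C := 6 * L * (B * (σ * (L ^ 2 + 6 * L) * Q) ^ 2)) (by
      intro x hx
      rw [uIoc_of_le hLL] at hx
      have hx := Ioc_subset_Icc_self hx
      obtain ⟨p0, p1⟩ := hp x hx
      rw [Real.norm_of_nonneg (by positivity), mul_pow (Real.exp _)]
      have : |q1 x - σ * (2 * (2 * L - x)) * q x| ≤ σ * (L ^ 2 + 6 * L) * Q := by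
        calc _ ≤ |q1 x| + |σ * (2 * (2 * L - x)) * q x| := abs_sub _ _
          _ = |q1 x| + σ * (2 * (2 * L - x)) * |q x| := by
            rw [abs_mul, abs_of_nonneg (by positivity : 0 ≤ σ * (2 * (2 * L - x)))]
          _ ≤ 1 * Q + σ * (6 * L) * Q := by
            rw [one_mul]; gcongr; exacts [hq1 x hx, hq x hx]
          _ ≤ σ * L ^ 2 * Q + σ * (6 * L) * Q := by gcongr
          _ = _ := by ring
      rw [← sq_abs (q1 x - _)]
      gcongr
      exact he x hx)
  have i2 := intervalIntegral.norm_integral_le_of_norm_le_const (a := -L) (b := L)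
    (f := fun x => (2 * (2 * L - x)) ^ 3 *
          (Real.exp (-(σ * (16 * L ^ 2 - (x - 2 * L) ^ 2))) * q x) ^ 2)
    (C := (6 * L) ^ 3 * (B * Q ^ 2)) (by
      intro x hx
      rw [uIoc_of_le hLL] at hx
      have hx := Ioc_subset_Icc_self hx
      obtain ⟨p0, p1⟩ := hp x hx
      rw [Real.norm_of_nonneg (by positivity), mul_pow (Real.exp _), ← sq_abs (q x)]
      gcongr
      exacts [he x hx, hq x hx])
  rw [show |L - -L| = 2 * L by rw [abs_of_nonneg] <;> linarith, Real.norm_eq_abs] at i1 i2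
  refine (abs_add_le _ _).trans ?_
  rw [abs_mul, abs_mul (1 / 2 * σ ^ 3), abs_of_nonneg (by positivity : 0 ≤ 1 / 2 * σ ^ 3),
    abs_mul, abs_of_pos hσ, show |(-(3 / 2) : ℝ)| = 3 / 2 by norm_num]
  calc _ ≤ 3 / 2 * σ * (6 * L * (B * (σ * (L ^ 2 + 6 * L) * Q) ^ 2) * (2 * L))
        + 1 / 2 * σ ^ 3 * ((6 * L) ^ 3 * (B * Q ^ 2) * (2 * L)) := by gcongr
    _ = _ := by
      rw [hB]
      field_simp
      ring

theorem weight_parameter_bounds {T L s : ℝ} (hT : 0 < T) (hL : 0 < L)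
    (hs : T / L + 4 * T + T ^ 2 + T ^ 2 / L ^ 2 ≤ s) :
    0 < s ∧ T / s ≤ L ∧ T / s ≤ 1 / 4 ∧
      ∀ t ∈ Ioo 0 T, 2 ≤ s / (t * (T - t)) ∧ 1 ≤ s / (t * (T - t)) * L ^ 2 := by
  have a1 : 0 < T / L := by positivity
  have a2 : 0 < T ^ 2 / L ^ 2 := by positivity
  have a3 : 0 < T ^ 2 := by positivity
  have hs0 : 0 < s := by linarith
  have b1 : T / L ≤ s := by linarith
  have b2 : T ^ 2 / L ^ 2 ≤ s := by linarith
  rw [div_le_iff₀ (by positivity)] at b1 b2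
  refine ⟨hs0, by rw [div_le_iff₀ hs0]; linarith, by rw [div_le_iff₀ hs0]; linarith,
    fun t ht => ?_⟩
  have h0 : 0 < t * (T - t) := mul_pos ht.1 (sub_pos.2 ht.2)
  have h1 : 4 * (t * (T - t)) ≤ T ^ 2 := by nlinarith [sq_nonneg (2 * t - T)]
  rw [le_div_iff₀ h0, div_mul_eq_mul_div, le_div_iff₀ h0]
  constructor <;> nlinarith

theorem hasDerivAt_weight {T s t : ℝ} (ht : t ∈ Ioo 0 T) :
    HasDerivAt (fun t => s / (t * (T - t))) (-(s * (T - 2 * t) / (t * (T - t)) ^ 2)) t := by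
  have h0 : t * (T - t) ≠ 0 := (mul_pos ht.1 (sub_pos.2 ht.2)).ne'
  refine ((hasDerivAt_const t s).div ((hasDerivAt_id t).mul
    ((hasDerivAt_id t).const_sub T)) h0).congr_deriv ?_
  simp
  ring

theorem abs_deriv_weight_le {T s t : ℝ} (hs : 0 < s) (ht : t ∈ Ioo 0 T) :
    |-(s * (T - 2 * t) / (t * (T - t)) ^ 2)| ≤ T / s * (s / (t * (T - t))) ^ 2 := by
  have h0 : 0 < t * (T - t) := mul_pos ht.1 (sub_pos.2 ht.2)
  have h1 : |T - 2 * t| ≤ T := abs_le.2 ⟨by linarith [ht.2], by linarith [ht.1]⟩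
  rw [abs_neg, abs_div, abs_mul, abs_of_pos hs, abs_of_pos (pow_pos h0 2), div_pow,
    show T / s * (s ^ 2 / (t * (T - t)) ^ 2) = s * T / (t * (T - t)) ^ 2 by field_simp]
  gcongr

theorem continuousOn_weight {T s : ℝ} : ContinuousOn (fun t => s / (t * (T - t))) (Ioo 0 T) :=
  fun _ ht => (hasDerivAt_weight ht).continuousAt.continuousWithinAt

/-- A function on `[0, T]` dominated by `C * (t * (T - t))` and continuous inside is continuous. -/
theorem continuousOn_Icc_of_le_mul {T C : ℝ} {G : ℝ → ℝ} (hG : ContinuousOn G (Ioo 0 T))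
    (hC : ∀ t ∈ Icc 0 T, |G t| ≤ C * (t * (T - t))) : ContinuousOn G (Icc 0 T) := by
  intro t ht
  by_cases h : t ∈ Ioo 0 T
  · exact (hG.continuousAt (isOpen_Ioo.mem_nhds h)).continuousWithinAt
  · have h0 : t * (T - t) = 0 := by
      simp only [mem_Ioo, not_and_or, not_lt] at h
      rcases h with h | h
      · rw [le_antisymm h ht.1, zero_mul]
      · rw [le_antisymm ht.2 h, sub_self, mul_zero]
    have hGt : G t = 0 := by simpa [h0] using hC t ht
    rw [ContinuousWithinAt, hGt]
    refine squeeze_zero_norm' (eventually_of_mem self_mem_nhdsWithin hC) ?_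
    have : Tendsto (fun t => C * (t * (T - t))) (𝓝[Icc 0 T] t) (𝓝 (C * (t * (T - t)))) :=
      (by fun_prop : Continuous fun t => C * (t * (T - t))).continuousWithinAt
    rwa [h0, mul_zero] at this

theorem integrableOn_integral_of_continuousOn_of_le {a b c d C : ℝ} {F : ℝ → ℝ → ℝ}
    (hF : ContinuousOn (Function.uncurry F) (Ioo a b ×ˢ Icc c d))
    (hC : ∀ t ∈ Ioo a b, ∀ x ∈ Icc c d, |F t x| ≤ C) :
    IntegrableOn (fun t => ∫ x in Icc c d, F t x) (Ioo a b) := by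
  have hm : MeasurableSet (Ioo a b ×ˢ Icc c d) := measurableSet_Ioo.prod measurableSet_Icc
  have h : IntegrableOn (Function.uncurry F) (Ioo a b ×ˢ Icc c d) (volume.prod volume) := by
    refine IntegrableOn.of_bound ?_ (hF.aestronglyMeasurable hm) C ?_
    · rw [Measure.prod_prod]
      exact ENNReal.mul_lt_top (by simp) (by simp)
    · exact ae_restrict_of_forall_mem hm fun z hz => hC z.1 hz.1 z.2 hz.2
  rw [IntegrableOn, ← Measure.prod_restrict] at h
  exact h.integral_prod_left

theorem integral_le_of_energy {T : ℝ} (hT : 0 < T) {G G' E R : ℝ → ℝ} {K : ℝ} (hK : 0 < K)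
    (hGc : ContinuousOn G (Icc 0 T)) (hG : ∀ t ∈ Ioo 0 T, HasDerivAt G (G' t) t)
    (h0 : G 0 = 0) (h1 : G T = 0) (hR : IntegrableOn R (Ioo 0 T)) (hR0 : ∀ t, 0 ≤ R t)
    (hle : ∀ t ∈ Ioo 0 T, 4 * G' t ≤ 2 * R t - K⁻¹ * E t) :
    ∫ t in Ioo 0 T, E t ≤ 2 * K * ∫ t in Ioo 0 T, R t := by
  by_cases hE : IntegrableOn E (Ioo 0 T)
  · have hI : IntegrableOn (fun t => 2 * R t - K⁻¹ * E t) (Ioo 0 T) :=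
      (hR.const_mul 2).sub (hE.const_mul K⁻¹)
    have h := intervalIntegral.sub_le_integral_of_hasDeriv_right_of_le (g := fun t => 4 * G t)
      (g' := fun t => 4 * G' t) hT.le (continuousOn_const.mul hGc)
      (fun t ht => ((hG t ht).const_mul 4).hasDerivWithinAt)
      ((integrableOn_Icc_iff_integrableOn_Ioo).2 hI) hle
    rw [h0, h1, sub_self, intervalIntegral.integral_of_le hT.le, integral_Ioc_eq_integral_Ioo,
      integral_sub (hR.const_mul 2) (hE.const_mul K⁻¹), integral_const_mul, integral_const_mul,
      sub_nonneg, inv_mul_le_iff₀ hK] at h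
    linarith
  · rw [integral_undef hE]
    have : 0 ≤ ∫ t in Ioo 0 T, R t := integral_nonneg hR0
    positivity

/-- Lemma 3.6 (Carleman estimate) for the operator `∂_t - ∂_x² + ∂_x³` on
`(0,T) × (-L,L)`, with boundary conditions up to second order. -/
theorem stmt_12 (T L : ℝ) (hT : 0 < T) (hL : 0 < L) :
    ∃ ψ : ℝ → ℝ, ContDiff ℝ (⊤ : ℕ∞) ψ ∧ (∀ x ∈ Icc (-L) L, 0 < ψ x) ∧
    ∃ s₀ Cc : ℝ, 0 < s₀ ∧ 0 < Cc ∧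
      ∀ s : ℝ, s₀ ≤ s →
      ∀ q qt qx qxx qxxx : ℝ → ℝ → ℝ,
        -- regularity of `q` in time and space
        (∀ t ∈ Icc (0:ℝ) T, ∀ x ∈ Icc (-L) L,
          HasDerivWithinAt (fun s' => q s' x) (qt t x) (Icc (0:ℝ) T) t) →
        (∀ t ∈ Icc (0:ℝ) T, ∀ x ∈ Icc (-L) L,
          HasDerivWithinAt (q t) (qx t x) (Icc (-L) L) x) →
        (∀ t ∈ Icc (0:ℝ) T, ∀ x ∈ Icc (-L) L,
          HasDerivWithinAt (qx t) (qxx t x) (Icc (-L) L) x) →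
        (∀ t ∈ Icc (0:ℝ) T, ∀ x ∈ Icc (-L) L,
          HasDerivWithinAt (qxx t) (qxxx t x) (Icc (-L) L) x) →
        ContinuousOn (Function.uncurry q) (Icc (0:ℝ) T ×ˢ Icc (-L) L) →
        ContinuousOn (Function.uncurry qt) (Icc (0:ℝ) T ×ˢ Icc (-L) L) →
        ContinuousOn (Function.uncurry qx) (Icc (0:ℝ) T ×ˢ Icc (-L) L) →
        ContinuousOn (Function.uncurry qxx) (Icc (0:ℝ) T ×ˢ Icc (-L) L) →
        ContinuousOn (Function.uncurry qxxx) (Icc (0:ℝ) T ×ˢ Icc (-L) L) →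
        -- boundary conditions
        (∀ t ∈ Icc (0:ℝ) T, q t (-L) = 0 ∧ q t L = 0 ∧ qx t (-L) = 0 ∧
          qx t L = 0 ∧ qxx t (-L) = 0 ∧ qxx t L = 0) →
        -- the Carleman estimate
        (∫ t in Ioo (0:ℝ) T, ∫ x in Icc (-L) L,
            (s^5 / (t^5 * (T - t)^5) * (q t x)^2
              + s^3 / (t^3 * (T - t)^3) * (qx t x)^2
              + s / (t * (T - t)) * (qxx t x)^2)
              * Real.exp (-2 * s * ψ x / (t * (T - t)))) ≤
          Cc * ∫ t in Ioo (0:ℝ) T, ∫ x in Icc (-L) L,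
            (qt t x - qxx t x + qxxx t x)^2
              * Real.exp (-2 * s * ψ x / (t * (T - t))) := by
  refine ⟨fun x => 16 * L ^ 2 - (x - 2 * L) ^ 2, by fun_prop, fun x hx => ?_,
    T / L + 4 * T + T ^ 2 + T ^ 2 / L ^ 2, 2 * (1 / L ^ 4 + 1 / L ^ 2 + 12),
    by positivity, by positivity, ?_⟩
  · nlinarith [hx.1, hx.2, mul_pos hL hL]
  intro s hs q qt qx qxx qxxx hqt hqx hqxx hqxxx cq cqt cqx cqxx cqxxx hb
  have hK : 0 < 1 / L ^ 4 + 1 / L ^ 2 + 12 := by positivity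
  obtain ⟨hs0, hs1, hs2, hst⟩ := weight_parameter_bounds hT hL hs
  have hLL : -L ≤ L := by linarith
  set S : Set (ℝ × ℝ) := Ioo 0 T ×ˢ Icc (-L) L
  have hsub : S ⊆ Icc 0 T ×ˢ Icc (-L) L := prod_mono Ioo_subset_Icc_self subset_rfl
  obtain ⟨σ, hσ⟩ : ∃ σ : ℝ → ℝ, σ = fun t => s / (t * (T - t)) := ⟨_, rfl⟩
  obtain ⟨σ', hσ'⟩ : ∃ σ' : ℝ → ℝ, σ' = fun t => -(s * (T - 2 * t) / (t * (T - t)) ^ 2) :=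
    ⟨_, rfl⟩
  have hpos : ∀ t ∈ Ioo 0 T, 0 < t * (T - t) := fun t ht => mul_pos ht.1 (sub_pos.2 ht.2)
  have dσ : ∀ t ∈ Ioo 0 T, HasDerivAt σ (σ' t) t := fun t ht => by
    rw [hσ, hσ']; exact hasDerivAt_weight ht
  have kσ : ContinuousOn (fun z : ℝ × ℝ => σ z.1) S := by
    rw [hσ]; exact continuousOn_weight.comp continuousOn_fst fun z hz => hz.1
  have kσ' : ContinuousOn (fun z : ℝ × ℝ => σ' z.1) S := by
    rw [hσ']
    exact (ContinuousOn.div (by fun_prop) (by fun_prop)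
      fun z hz => (pow_pos (hpos z.1 hz.1) 2).ne').neg
  obtain ⟨g, hg⟩ : ∃ g : ℝ × ℝ → ℝ, ∀ z, σ z.1 = g z := ⟨fun z => σ z.1, fun _ => rfl⟩
  obtain ⟨g', hg'⟩ : ∃ g' : ℝ × ℝ → ℝ, ∀ z, σ' z.1 = g' z := ⟨fun z => σ' z.1, fun _ => rfl⟩
  have kg : ContinuousOn g S := kσ.congr fun z _ => (hg z).symm
  have kg' : ContinuousOn g' S := kσ'.congr fun z _ => (hg' z).symm
  obtain ⟨e, he⟩ : ∃ e : ℝ → ℝ → ℝ,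
    e = fun t x => Real.exp (-(σ t * (16 * L ^ 2 - (x - 2 * L) ^ 2))) := ⟨_, rfl⟩
  have ke : ContinuousOn (fun z : ℝ × ℝ => e z.1 z.2) S := by
    simp only [he, hg]; fun_prop
  have he2 : ∀ t x, Real.exp (-2 * s * (16 * L ^ 2 - (x - 2 * L) ^ 2) / (t * (T - t))) =
      e t x ^ 2 := fun t x => by
    rw [he, hσ, ← Real.exp_nat_mul]; congr 1; push_cast; ring
  have dex : ∀ t {f : ℝ → ℝ} {f' x : ℝ}, HasDerivWithinAt f f' (Icc (-L) L) x →
      HasDerivWithinAt (fun x => e t x * f x)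
        (e t x * (f' - σ t * (2 * (2 * L - x)) * f x)) (Icc (-L) L) x := fun t f f' x h => by
    rw [he]; exact hasDerivWithinAt_conj h
  have det : ∀ t ∈ Ioo 0 T, ∀ x, HasDerivAt (fun r => e r x)
      (e t x * -(σ' t * (16 * L ^ 2 - (x - 2 * L) ^ 2))) t := fun t ht x => by
    rw [he]; exact ((dσ t ht).mul_const _).neg.exp
  have kq : ContinuousOn (fun z : ℝ × ℝ => q z.1 z.2) S := cq.mono hsub
  have kqt : ContinuousOn (fun z : ℝ × ℝ => qt z.1 z.2) S := cqt.mono hsub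
  have kqx : ContinuousOn (fun z : ℝ × ℝ => qx z.1 z.2) S := cqx.mono hsub
  have kqxx : ContinuousOn (fun z : ℝ × ℝ => qxx z.1 z.2) S := cqxx.mono hsub
  have kqxxx : ContinuousOn (fun z : ℝ × ℝ => qxxx z.1 z.2) S := cqxxx.mono hsub
  obtain ⟨w, hw⟩ : ∃ w : ℝ → ℝ → ℝ, w = fun t x => e t x * q t x := ⟨_, rfl⟩
  obtain ⟨w1, hw1⟩ : ∃ w1 : ℝ → ℝ → ℝ, w1 = fun t x =>
    e t x * (qx t x - σ t * (2 * (2 * L - x)) * q t x) := ⟨_, rfl⟩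
  obtain ⟨w2, hw2⟩ : ∃ w2 : ℝ → ℝ → ℝ, w2 = fun t x =>
    e t x * (qxx t x - 2 * (σ t * (2 * (2 * L - x))) * qx t x
      + ((σ t * (2 * (2 * L - x))) ^ 2 + 2 * σ t) * q t x) := ⟨_, rfl⟩
  obtain ⟨w3, hw3⟩ : ∃ w3 : ℝ → ℝ → ℝ, w3 = fun t x =>
    e t x * (qxxx t x - 3 * (σ t * (2 * (2 * L - x))) * qxx t x
      + (3 * (σ t * (2 * (2 * L - x))) ^ 2 + 6 * σ t) * qx t x
      - ((σ t * (2 * (2 * L - x))) ^ 3 + 6 * σ t * (σ t * (2 * (2 * L - x)))) * q t x) := ⟨_, rfl⟩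
  obtain ⟨wt, hwt⟩ : ∃ wt : ℝ → ℝ → ℝ, wt = fun t x =>
    e t x * (qt t x - σ' t * (16 * L ^ 2 - (x - 2 * L) ^ 2) * q t x) := ⟨_, rfl⟩
  obtain ⟨f, hf⟩ : ∃ f : ℝ → ℝ → ℝ, f = fun t x =>
    e t x * (qt t x - qxx t x + qxxx t x) := ⟨_, rfl⟩
  obtain ⟨E, hE⟩ : ∃ E : ℝ → ℝ → ℝ, E = fun t x =>
    e t x ^ 2 * (σ t ^ 5 * q t x ^ 2 + σ t ^ 3 * qx t x ^ 2 + σ t * qxx t x ^ 2) := ⟨_, rfl⟩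
  have kw : ContinuousOn (fun z : ℝ × ℝ => w z.1 z.2) S := by rw [hw]; fun_prop
  have kw1 : ContinuousOn (fun z : ℝ × ℝ => w1 z.1 z.2) S := by
    simp only [hw1, hg]; fun_prop
  have kw2 : ContinuousOn (fun z : ℝ × ℝ => w2 z.1 z.2) S := by
    simp only [hw2, hg]; fun_prop
  have kw3 : ContinuousOn (fun z : ℝ × ℝ => w3 z.1 z.2) S := by
    simp only [hw3, hg]; fun_prop
  have kwt : ContinuousOn (fun z : ℝ × ℝ => wt z.1 z.2) S := by
    simp only [hwt, hg']; fun_prop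
  have kf : ContinuousOn (fun z : ℝ × ℝ => f z.1 z.2) S := by rw [hf]; fun_prop
  have kE : ContinuousOn (fun z : ℝ × ℝ => E z.1 z.2) S := by
    simp only [hE, hg]; fun_prop
  have slice : ∀ {g : ℝ → ℝ → ℝ}, ContinuousOn (fun z : ℝ × ℝ => g z.1 z.2) S →
      ∀ t ∈ Ioo 0 T, ContinuousOn (g t) (Icc (-L) L) := fun {g} hg t ht =>
    hg.comp (f := fun x => (t, x)) (by fun_prop) (fun x hx => ⟨ht, hx⟩)
  have dwt : ∀ t ∈ Ioo 0 T, ∀ x ∈ Icc (-L) L, HasDerivAt (fun r => w r x) (wt t x) t := by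
    intro t ht x hx
    rw [hw, hwt]
    refine ((det t ht x).mul ((hqt t (Ioo_subset_Icc_self ht) x hx).hasDerivAt
      (Icc_mem_nhds ht.1 ht.2))).congr_deriv ?_
    ring
  have dw : ∀ t ∈ Ioo 0 T, ∀ x ∈ Icc (-L) L,
      HasDerivWithinAt (w t) (w1 t x) (Icc (-L) L) x := by
    intro t ht x hx
    rw [hw, hw1]
    exact dex t (hqx t (Ioo_subset_Icc_self ht) x hx)
  have da : ∀ t x, HasDerivWithinAt (fun x => σ t * (2 * (2 * L - x))) (σ t * (2 * (-1)))
      (Icc (-L) L) x := fun t x =>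
    (((hasDerivWithinAt_id x _).const_sub (2 * L)).const_mul 2).const_mul (σ t)
  have dw1 : ∀ t ∈ Ioo 0 T, ∀ x ∈ Icc (-L) L,
      HasDerivWithinAt (w1 t) (w2 t x) (Icc (-L) L) x := by
    intro t ht x hx
    have ht' := Ioo_subset_Icc_self ht
    rw [hw1, hw2]
    refine (dex t ((hqxx t ht' x hx).sub ((da t x).mul (hqx t ht' x hx)))).congr_deriv ?_
    simp only [Pi.sub_apply, Pi.mul_apply]
    ring
  have dw2 : ∀ t ∈ Ioo 0 T, ∀ x ∈ Icc (-L) L,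
      HasDerivWithinAt (w2 t) (w3 t x) (Icc (-L) L) x := by
    intro t ht x hx
    have ht' := Ioo_subset_Icc_self ht
    rw [hw2, hw3]
    refine (dex t (((hqxxx t ht' x hx).sub (((da t x).const_mul 2).mul (hqxx t ht' x hx))).add
      ((((da t x).pow 2).add_const (2 * σ t)).mul (hqx t ht' x hx)))).congr_deriv ?_
    simp only [Pi.sub_apply, Pi.mul_apply, Pi.add_apply, Pi.pow_apply]
    push_cast
    ring
  have bw : ∀ t ∈ Ioo 0 T, w t (-L) = 0 ∧ w t L = 0 ∧ w1 t (-L) = 0 ∧ w1 t L = 0 ∧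
      w2 t (-L) = 0 ∧ w2 t L = 0 := by
    intro t ht
    obtain ⟨b1, b2, b3, b4, b5, b6⟩ := hb t (Ioo_subset_Icc_self ht)
    simp [hw, hw1, hw2, b1, b2, b3, b4, b5, b6]
  have dG := fun t (ht : t ∈ Ioo 0 T) => hasDerivAt_energy hL isOpen_Ioo ht (dσ t ht) dwt dw dw1
    kw kwt kw1 kw2 fun τ hτ => ⟨(bw τ hτ).1, (bw τ hτ).2.1⟩
  have hGE : ∀ t ∈ Ioo 0 T, _ := fun t ht =>
    energy_deriv_le (κ := T / s) (σ := σ t) (σ' := σ' t) hL hs1 hs2 (by rw [hσ]; exact (hst t ht).1)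
      (by rw [hσ]; exact (hst t ht).2) (by rw [hσ, hσ']; exact abs_deriv_weight_le hs0 ht)
      (dw t ht) (dw1 t ht) (dw2 t ht) (slice kw3 t ht) (slice kwt t ht) (bw t ht)
      (f := f t) (E := E t) (slice kf t ht) (slice kE t ht)
      (fun x _ => by rw [hf, hwt, hw, hw1, hw2, hw3]; ring)
      (fun x _ => by rw [hE, hw, hw1, hw2]; ring)
  have hcomp : IsCompact (Icc 0 T ×ˢ Icc (-L) L) := isCompact_Icc.prod isCompact_Icc
  obtain ⟨Q0, hQ0⟩ := hcomp.exists_bound_of_continuousOn cq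
  obtain ⟨Q1, hQ1⟩ := hcomp.exists_bound_of_continuousOn cqx
  obtain ⟨Q, hQ⟩ := hcomp.exists_bound_of_continuousOn ((cqt.sub cqxx).add cqxxx)
  have hGc := continuousOn_Icc_of_le_mul (fun t ht => (dG t ht).continuousAt.continuousWithinAt)
    (C := (24 / (14 * L ^ 2) ^ 4 * max Q0 Q1 ^ 2 *
      (18 * L ^ 2 * (L ^ 2 + 6 * L) ^ 2 + 216 * L ^ 4)) / s) (by
    intro t ht
    by_cases hti : t ∈ Ioo 0 T
    · have h := energy_bound hL (div_pos hs0 (hpos t hti)) (hst t hti).2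
        (fun x hx => (hQ0 (t, x) ⟨ht, hx⟩).trans (le_max_left Q0 Q1))
        (fun x hx => (hQ1 (t, x) ⟨ht, hx⟩).trans (le_max_right Q0 Q1))
      rw [div_div_eq_mul_div, ← div_mul_eq_mul_div] at h
      rw [hw, hw1, he, hσ]
      exact h
    · have h0 : t * (T - t) = 0 := by
        simp only [mem_Ioo, not_and_or, not_lt] at hti
        rcases hti with h | h
        · rw [le_antisymm h ht.1, zero_mul]
        · rw [le_antisymm ht.2 h, sub_self, mul_zero]
      simp [hσ, h0])
  have main := integral_le_of_energy hT hK hGc dG (by simp [hσ]) (by simp [hσ])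
    (R := fun t => ∫ x in (-L)..L, f t x ^ 2) (E := fun t => ∫ x in (-L)..L, E t x) ?_
    (fun t => intervalIntegral.integral_nonneg hLL fun x _ => sq_nonneg _) hGE
  · simp only [intervalIntegral.integral_of_le hLL, ← integral_Icc_eq_integral_Ioc] at main
    have e1 : ∀ t x, (s ^ 5 / (t ^ 5 * (T - t) ^ 5) * q t x ^ 2
        + s ^ 3 / (t ^ 3 * (T - t) ^ 3) * qx t x ^ 2 + s / (t * (T - t)) * qxx t x ^ 2)
        * Real.exp (-2 * s * (16 * L ^ 2 - (x - 2 * L) ^ 2) / (t * (T - t))) = E t x := by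
      intro t x
      rw [he2, hE, hσ]
      simp only [div_pow, mul_pow]
      ring
    have e2 : ∀ t x, (qt t x - qxx t x + qxxx t x) ^ 2
        * Real.exp (-2 * s * (16 * L ^ 2 - (x - 2 * L) ^ 2) / (t * (T - t))) = f t x ^ 2 := by
      intro t x
      rw [he2, hf]
      ring
    simp only [e1, e2]
    exact main
  · simp only [intervalIntegral.integral_of_le hLL, ← integral_Icc_eq_integral_Ioc]
    refine integrableOn_integral_of_continuousOn_of_le (C := Q ^ 2) (kf.pow 2) ?_
    intro t ht x hx
    have h1 := hQ (t, x) ⟨Ioo_subset_Icc_self ht, hx⟩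
    have h2 : |e t x| ≤ 1 := by
      rw [he, Real.abs_exp, Real.exp_le_one_iff, hσ]
      have := div_pos hs0 (hpos t ht)
      have : 0 ≤ 16 * L ^ 2 - (x - 2 * L) ^ 2 := by nlinarith [hx.1, hx.2]
      simp only [Left.neg_nonpos_iff]
      positivity
    rw [abs_pow, hf]
    refine pow_le_pow_left₀ (abs_nonneg _) ?_ 2
    rw [abs_mul, ← one_mul Q]
    exact mul_le_mul h2 h1 (abs_nonneg _) zero_le_one
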